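/- Let p be a prime, n ≥ 1, and let Ψ be a transitive automorphism of ℙⁿ over F_p with fractional jump ψ : F_pⁿ → F_pⁿ. Then there exist polynomials a_j^{(i)}, b^{(i)} ∈ F_p[x_1,…,x_n] of total degree at most 1, for i ∈ {1,…,p−1} and j ∈ {1,…,n}, with each b^{(i)} not identically equal to any constant, such that for every i ∈ {1,…,p−1} and every x ∈ F_pⁿ lying outside ⋃_{k=1}^{i} V(b^{(k)}), the j-th component of ψ^i(x) equals a_j^{(i)}(x)/b^{(i)}(x) for all j ∈ {1,…,n}. -/

import Mathlib

open Polynomial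

def IsTransitiveMap {X : Type*} (f : X → X) : Prop :=
  ∀ x y : X, ∃ i : ℕ, f^[i] x = y

noncomputable def projMap {F : Type*} [Field F] {n : ℕ}
    (M : (Fin (n + 1) → F) ≃ₗ[F] (Fin (n + 1) → F)) :
    Projectivization F (Fin (n + 1) → F) → Projectivization F (Fin (n + 1) → F) :=
  Projectivization.map M.toLinearMap M.injective

/-- `P` lies in the affine chart `U = {Xₙ ≠ 0}`. -/
noncomputable def inU {F : Type*} [Field F] {n : ℕ}
    (P : Projectivization F (Fin (n + 1) → F)) : Prop :=
  P.rep (Fin.last n) ≠ 0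

noncomputable def toProj {F : Type*} [Field F] {n : ℕ} (x : Fin n → F) :
    Projectivization F (Fin (n + 1) → F) :=
  Projectivization.mk F (Fin.snoc x 1) (by
    intro h
    simpa using congrFun h (Fin.last n))

noncomputable def toAff {F : Type*} [Field F] {n : ℕ}
    (P : Projectivization F (Fin (n + 1) → F)) : Fin n → F :=
  fun i => P.rep i.castSucc / P.rep (Fin.last n)

noncomputable def jumpIndex {F : Type*} [Field F] {n : ℕ}
    (Ψ : Projectivization F (Fin (n + 1) → F) → Projectivization F (Fin (n + 1) → F))
    (P : Projectivization F (Fin (n + 1) → F)) : ℕ :=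
  sInf {k : ℕ | 1 ≤ k ∧ inU (Ψ^[k] P)}

noncomputable def fracJump {F : Type*} [Field F] {n : ℕ}
    (M : (Fin (n + 1) → F) ≃ₗ[F] (Fin (n + 1) → F)) (x : Fin n → F) : Fin n → F :=
  toAff ((projMap M)^[jumpIndex (projMap M) (toProj x)] (toProj x))

def ProjectivelyPrimitive {F : Type*} [Field F] (χ : Polynomial F) : Prop :=
  Irreducible χ ∧
  ∀ (K : Type) [Field K] [Algebra F K], Module.finrank F K = χ.natDegree →
    ∀ α : Kˣ, Polynomial.aeval (α : K) χ = 0 →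
      Subgroup.zpowers
        (QuotientGroup.mk (s := (Units.map (algebraMap F K).toMonoidHom).range) α) = ⊤

noncomputable def ep (p : ℕ) (z : ZMod p) : ℂ :=
  Complex.exp (2 * Real.pi * Complex.I * (z.val : ℂ) / p)

noncomputable def snake {A : Type*} {n : ℕ} (hn : 0 < n)
    (ψ : (Fin n → A) → (Fin n → A)) (x : Fin n → A) (m : ℕ) : A :=
  ψ^[(m - 1) / n] x ⟨(m - 1) % n, Nat.mod_lt _ hn⟩

open scoped Classical in
noncomputable def discrepancy (s N : ℕ) (γ : ℕ → Fin s → ℝ) : ℝ :=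
  ⨆ α : Fin s → ℝ, ⨆ β : Fin s → ℝ,
    ⨆ _ : ∀ i, 0 ≤ α i ∧ α i ≤ β i ∧ β i ≤ 1,
      |(((Finset.range N).filter fun m => ∀ i, α i ≤ γ m i ∧ γ m i < β i).card : ℝ) / N
        - ∏ i, (β i - α i)|

noncomputable def Dsnake {p n : ℕ} (hn : 0 < n)
    (ψ : (Fin n → ZMod p) → (Fin n → ZMod p)) (s N : ℕ) (x : Fin n → ZMod p) : ℝ :=
  discrepancy s N fun m i => ((snake hn ψ x (m + 1 + i)).val : ℝ) / p

noncomputable def DsnakeN {p n : ℕ} (hn : 0 < n)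
    (ψ : (Fin n → ZMod p) → (Fin n → ZMod p)) (s N : ℕ) (x : Fin n → ZMod p) : ℝ :=
  discrepancy (s * n) N fun m i => ((snake hn ψ x (m * n + 1 + i)).val : ℝ) / p

section Chart

variable {F : Type*} [Field F] {n : ℕ}

theorem inU_mk {v : Fin (n + 1) → F} (hv : v ≠ 0) :
    inU (Projectivization.mk F v hv) ↔ v (Fin.last n) ≠ 0 := by
  obtain ⟨a, ha⟩ := Projectivization.exists_smul_eq_mk_rep F v hv
  rw [inU, ← ha]
  simp [Units.smul_def]

theorem toAff_mk {v : Fin (n + 1) → F} (hv : v ≠ 0) (j : Fin n) :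
    toAff (Projectivization.mk F v hv) j = v j.castSucc / v (Fin.last n) := by
  obtain ⟨a, ha⟩ := Projectivization.exists_smul_eq_mk_rep F v hv
  rw [toAff, ← ha]
  simp [Units.smul_def, mul_div_mul_left]

theorem toAff_toProj (x : Fin n → F) : toAff (toProj x) = x := by
  funext j
  simp [toProj, toAff_mk]

theorem toProj_toAff {P : Projectivization F (Fin (n + 1) → F)} (hP : inU P) :
    toProj (toAff P) = P := by
  conv_rhs => rw [← P.mk_rep]
  rw [toProj, Projectivization.mk_eq_mk_iff']
  have h : P.rep (Fin.last n) ≠ 0 := hP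
  refine ⟨(P.rep (Fin.last n))⁻¹, ?_⟩
  funext j
  refine Fin.lastCases ?_ (fun j => ?_) j
  · simp [h]
  · simp [toAff, div_eq_inv_mul]

variable (M : (Fin (n + 1) → F) ≃ₗ[F] (Fin (n + 1) → F))

theorem pow_toLinearMap_ne_zero (k : ℕ) {v : Fin (n + 1) → F} (hv : v ≠ 0) :
    (M.toLinearMap ^ k) v ≠ 0 := by
  rw [Module.End.pow_apply]
  intro h
  have h0 : (M.toLinearMap)^[k] 0 = 0 := Function.iterate_fixed (map_zero _) k
  exact hv (M.injective.iterate k (h.trans h0.symm))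

theorem projMap_iterate_mk (k : ℕ) {v : Fin (n + 1) → F} (hv : v ≠ 0) :
    (projMap M)^[k] (Projectivization.mk F v hv) =
      Projectivization.mk F ((M.toLinearMap ^ k) v) (pow_toLinearMap_ne_zero M k hv) := by
  induction k with
  | zero => simp
  | succ k ih =>
    rw [Function.iterate_succ_apply', ih]
    simp only [projMap, Projectivization.map_mk, pow_succ', Module.End.mul_apply]

theorem toProj_fracJump {x : Fin n → F} (hx : inU (projMap M (toProj x))) :
    toProj (fracJump M x) = projMap M (toProj x) := by
  have h : jumpIndex (projMap M) (toProj x) = 1 :=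
    le_antisymm (Nat.sInf_le ⟨le_rfl, hx⟩) (le_csInf ⟨1, le_rfl, hx⟩ fun _ hk => hk.1)
  rw [fracJump, h, Function.iterate_one, toProj_toAff hx]

theorem toProj_fracJump_iterate {x : Fin n → F} {i : ℕ}
    (hx : ∀ k, 1 ≤ k → k ≤ i → inU ((projMap M)^[k] (toProj x))) :
    toProj ((fracJump M)^[i] x) = (projMap M)^[i] (toProj x) := by
  induction i with
  | zero => rfl
  | succ i ih =>
    have hi := ih fun k hk hki => hx k hk (hki.trans i.le_succ)
    have h := hx (i + 1) i.succ_pos le_rfl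
    rw [Function.iterate_succ_apply', ← hi] at h
    rw [Function.iterate_succ_apply', Function.iterate_succ_apply', toProj_fracJump M h, hi]

end Chart

section AffineForm

variable {F : Type*} [Field F] {n : ℕ}

/-- The dehomogenization of a linear form, with the last variable set to `1`. -/
noncomputable def affineForm (f : (Fin (n + 1) → F) →ₗ[F] F) : MvPolynomial (Fin n) F :=
  ∑ j : Fin n, MvPolynomial.C (f (Pi.single j.castSucc 1)) * MvPolynomial.X j +
    MvPolynomial.C (f (Pi.single (Fin.last n) 1))

theorem eval_affineForm (f : (Fin (n + 1) → F) →ₗ[F] F) (x : Fin n → F) :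
    MvPolynomial.eval x (affineForm f) = f (Fin.snoc x 1) := by
  rw [f.pi_apply_eq_sum_univ, Fin.sum_univ_castSucc]
  have h (i : Fin (n + 1)) : (fun j => if i = j then (1 : F) else 0) = Pi.single i 1 := by
    funext j
    simp [Pi.single_apply, eq_comm]
  simp [affineForm, h, mul_comm]

theorem totalDegree_affineForm_le (f : (Fin (n + 1) → F) →ₗ[F] F) :
    (affineForm f).totalDegree ≤ 1 := by
  refine (MvPolynomial.totalDegree_add _ _).trans (max_le ?_ (by simp))
  refine MvPolynomial.totalDegree_finsetSum_le fun j _ => ?_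
  refine (MvPolynomial.totalDegree_mul _ _).trans ?_
  simp

theorem apply_eq_zero_of_affineForm_eq_C {f : (Fin (n + 1) → F) →ₗ[F] F} {c : F}
    (hf : affineForm f = MvPolynomial.C c) {v : Fin (n + 1) → F} (hv : v (Fin.last n) = 0) :
    f v = 0 := by
  have h (x : Fin n → F) : f (Fin.snoc x 1) = c := by
    rw [← eval_affineForm, hf, MvPolynomial.eval_C]
  have hv' : v = Fin.snoc (Fin.init v) 1 - Fin.snoc (0 : Fin n → F) 1 := by
    funext j
    refine Fin.lastCases ?_ (fun j => ?_) j
    · simp [hv]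
    · simp [Fin.init]
  rw [hv', map_sub, h, h, sub_self]

end AffineForm

section Transitive

variable {F : Type*} [Field F] {n : ℕ} {M : (Fin (n + 1) → F) ≃ₗ[F] (Fin (n + 1) → F)}

/-- If a power of a transitive automorphism preserves the hyperplane at infinity, then the
preimages of this hyperplane cover the whole space. -/
theorem exists_pow_last_eq_zero_of_isTransitiveMap (hn : 1 ≤ n)
    (hM : IsTransitiveMap (projMap M)) {i : ℕ} (hi : 1 ≤ i)
    (h : ∀ v : Fin (n + 1) → F, v (Fin.last n) = 0 → (M.toLinearMap ^ i) v (Fin.last n) = 0)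
    (w : Fin (n + 1) → F) : ∃ k < i, (M.toLinearMap ^ k) w (Fin.last n) = 0 := by
  by_cases hw : w = 0
  · exact ⟨0, hi, by simp [hw]⟩
  have step (v : Fin (n + 1) → F) (hv : ∃ k < i, (M.toLinearMap ^ k) v (Fin.last n) = 0) :
      ∃ k < i, (M.toLinearMap ^ k) (M.toLinearMap v) (Fin.last n) = 0 := by
    obtain ⟨k, hk, hkv⟩ := hv
    rcases k with _ | k
    · refine ⟨i - 1, by omega, ?_⟩
      rw [← Module.End.mul_apply, ← pow_succ, Nat.sub_add_cancel hi]
      exact h v (by simpa using hkv)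
    · exact ⟨k, by omega, by rwa [← Module.End.mul_apply, ← pow_succ]⟩
  have orbit (m : ℕ) (v : Fin (n + 1) → F) (hv : v (Fin.last n) = 0) :
      ∃ k < i, (M.toLinearMap ^ k) ((M.toLinearMap ^ m) v) (Fin.last n) = 0 := by
    induction m with
    | zero => exact ⟨0, hi, by simpa using hv⟩
    | succ m ih =>
      rw [pow_succ', Module.End.mul_apply]
      exact step _ ih
  let v₀ : Fin (n + 1) → F := Pi.single 0 1
  have hv₀ : v₀ ≠ 0 := by simp [v₀]
  have hlast : v₀ (Fin.last n) = 0 := by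
    have : Fin.last n ≠ 0 := by
      rw [Ne, Fin.ext_iff]
      simp
      omega
    simp [v₀, this]
  obtain ⟨m, hm⟩ := hM (Projectivization.mk F v₀ hv₀) (Projectivization.mk F w hw)
  rw [projMap_iterate_mk, eq_comm, Projectivization.mk_eq_mk_iff'] at hm
  obtain ⟨a, rfl⟩ := hm
  obtain ⟨k, hk, hkv⟩ := orbit m v₀ hlast
  exact ⟨k, hk, by rw [map_smul, Pi.smul_apply, hkv, smul_zero]⟩

theorem card_le_of_forall_exists_pow_last_eq_zero [Fintype F] {i : ℕ}
    (h : ∀ w : Fin (n + 1) → F, ∃ k < i, (M.toLinearMap ^ k) w (Fin.last n) = 0) :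
    Fintype.card F ≤ i := by
  choose k hk hkw using h
  have hinj : Function.Injective fun w : Fin (n + 1) → F =>
      ((⟨k w, hk w⟩ : Fin i), Fin.init (α := fun _ => F) ((M.toLinearMap ^ k w) w)) := by
    intro v w hvw
    simp only [Prod.mk.injEq, Fin.mk.injEq] at hvw
    obtain ⟨h₁, h₂⟩ := hvw
    have hv := hkw v
    rw [h₁] at h₂ hv
    have heq : (M.toLinearMap ^ k w) v = (M.toLinearMap ^ k w) w := by
      rw [← Fin.snoc_init_self ((M.toLinearMap ^ k w) v), h₂, hv, ← hkw w, Fin.snoc_init_self]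
    simp only [Module.End.pow_apply] at heq
    exact M.injective.iterate _ heq
  have hcard := Fintype.card_le_of_injective _ hinj
  simp only [Fintype.card_prod, Fintype.card_fun, Fintype.card_fin, pow_succ'] at hcard
  exact Nat.le_of_mul_le_mul_right hcard (pow_pos Fintype.card_pos n)

end Transitive

/-- Explicit description of the iterates of a fractional jump: there are polynomials
`a_j^{(i)}, b^{(i)}` of degree at most `1`, with `b^{(i)}` not a constant, such that for
`1 ≤ i ≤ p - 1` and `x` outside `⋃_{k=1}^{i} V(b^{(k)})`, the `j`-th component of `ψ^i(x)`
is `a_j^{(i)}(x) / b^{(i)}(x)`. -/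
theorem statement10 (p : ℕ) [Fact p.Prime] (n : ℕ) (hn : 1 ≤ n)
    (M : (Fin (n + 1) → ZMod p) ≃ₗ[ZMod p] (Fin (n + 1) → ZMod p))
    (hM : IsTransitiveMap (projMap M)) :
    ∃ (a : ℕ → Fin n → MvPolynomial (Fin n) (ZMod p))
      (b : ℕ → MvPolynomial (Fin n) (ZMod p)),
      (∀ i j, 1 ≤ i → i ≤ p - 1 → (a i j).totalDegree ≤ 1) ∧
      (∀ i, 1 ≤ i → i ≤ p - 1 → (b i).totalDegree ≤ 1) ∧
      (∀ i, 1 ≤ i → i ≤ p - 1 → ∀ c : ZMod p, b i ≠ MvPolynomial.C c) ∧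
      (∀ i, 1 ≤ i → i ≤ p - 1 → ∀ x : Fin n → ZMod p,
        (∀ k, 1 ≤ k → k ≤ i → MvPolynomial.eval x (b k) ≠ 0) →
        ∀ j : Fin n, (fracJump M)^[i] x j =
          MvPolynomial.eval x (a i j) / MvPolynomial.eval x (b i)) := by
  let coord (i : ℕ) (j : Fin (n + 1)) : (Fin (n + 1) → ZMod p) →ₗ[ZMod p] ZMod p :=
    LinearMap.proj j ∘ₗ (M.toLinearMap ^ i)
  refine ⟨fun i j => affineForm (coord i j.castSucc), fun i => affineForm (coord i (Fin.last n)),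
    fun _ _ _ _ => totalDegree_affineForm_le _, fun _ _ _ => totalDegree_affineForm_le _,
    fun i hi hip c hc => ?_, fun i _ _ x hx j => ?_⟩
  · have hcard := card_le_of_forall_exists_pow_last_eq_zero
      (exists_pow_last_eq_zero_of_isTransitiveMap hn hM hi
        fun v hv => apply_eq_zero_of_affineForm_eq_C hc hv)
    rw [ZMod.card] at hcard
    have := (Fact.out : p.Prime).pos
    omega
  · have hU : ∀ k, 1 ≤ k → k ≤ i → inU ((projMap M)^[k] (toProj x)) := by
      intro k hk hki
      have := hx k hk hki
      rw [eval_affineForm] at this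
      rw [toProj, projMap_iterate_mk, inU_mk]
      exact this
    rw [← toAff_toProj ((fracJump M)^[i] x), toProj_fracJump_iterate M hU, toProj,
      projMap_iterate_mk, toAff_mk, eval_affineForm, eval_affineForm]
    rfl
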